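/- arXiv:1006.5581 — 2 statements merged into one kernel-verified Lean document; each statement's English description precedes it below -/
import Mathlib

section
/- Let G be a subgroup of GL(3,ℂ) every element of which lies in SU(2,1) (with respect to the Hermitian form of signature (2,1) with Gram matrix J = [[0,0,1],[0,1,0],[1,0,0]]). Assume G is discrete (the subspace topology induced on G from GL(3,ℂ) is discrete) and non-elementary, meaning there is no nonempty finite set S of one-dimensional complex subspaces ℂ·z of ℂ³, each spanned by a nonzero vector z with ⟨z,z⟩ ≤ 0, such that every element of G maps S into S. If the trace of every element of G is real, then G is Fuchsian: there exists T ∈ SU(2,1) such that either (a) for every g ∈ G all nine entries of T g T⁻¹ are real (G is ℝ-Fuchsian, conjugated into SO(2,1)), or (b) for every g ∈ G the matrix T g T⁻¹ has vanishing (1,2), (2,1), (2,3) and (3,2) entries (G is ℂ-Fuchsian, preserving the complex line with polar vector (0,1,0)). -/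
open Matrix Complex

noncomputable section

/-- The Gram matrix of the Hermitian form of signature (2,1). -/
def J21 : Matrix (Fin 3) (Fin 3) ℂ := !![0,0,1;0,1,0;1,0,0]

/-- The Hermitian form ⟨z,w⟩ = z₁·conj(w₃) + z₂·conj(w₂) + z₃·conj(w₁) on ℂ³. -/
def herm (z w : Fin 3 → ℂ) : ℂ :=
  z 0 * (starRingEnd ℂ) (w 2) + z 1 * (starRingEnd ℂ) (w 1) + z 2 * (starRingEnd ℂ) (w 0)

/-- Membership in SU(2,1): unitary for the form with Gram matrix `J`, determinant one. -/
def InSU21 (A : Matrix (Fin 3) (Fin 3) ℂ) : Prop := Aᴴ * J21 * A = J21 ∧ A.det = 1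

/-- Burnside theorem for subalgebras of `End ℂ (ℂ³)`. -/
lemma burnside_end (A : Subalgebra ℂ (Module.End ℂ (Fin 3 → ℂ)))
    (hirr : ∀ W : Submodule ℂ (Fin 3 → ℂ), (∀ a ∈ A, ∀ w ∈ W, a w ∈ W) → W = ⊥ ∨ W = ⊤) :
    A = ⊤ := by
  have hs : IsSimpleModule A (Fin 3 → ℂ) := by
    rw [isSimpleModule_iff]
    refine { exists_pair_ne := ⟨⊥, ⊤, bot_ne_top⟩, eq_bot_or_eq_top := ?_ }
    intro W
    rcases hirr (W.restrictScalars ℂ) (fun a ha w hw => by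
      have := W.smul_mem (⟨a, ha⟩ : A) hw
      exact this) with h | h
    · left
      exact (Submodule.restrictScalars_eq_bot_iff ..).1 h
    · right
      exact (Submodule.restrictScalars_eq_top_iff ..).1 h
  have hsur := (IsSimpleModule.algebraMap_end_bijective_of_isAlgClosed (A := A)
    (V := Fin 3 → ℂ) ℂ).2
  rw [eq_top_iff]
  rintro f -
  let f' : Module.End (Module.End A (Fin 3 → ℂ)) (Fin 3 → ℂ) :=
    { toFun := f
      map_add' := f.map_add
      map_smul' := by
        intro e x
        obtain ⟨c, rfl⟩ := hsur e
        simp }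
  obtain ⟨r, hr⟩ := jacobson_density (R := A) (M := Fin 3 → ℂ) f' (Finset.univ.image (fun i : Fin 3 => (Pi.single i 1 : Fin 3 → ℂ)))
  have : f = r.1 := by
    apply LinearMap.pi_ext'
    intro i
    ext1
    have : f (Pi.single i 1) = r.1 (Pi.single i 1) := hr (Pi.single i 1) (by simp)
    simpa using this
  rw [this]
  exact r.2

lemma burnside_mat (S : Set (Matrix (Fin 3) (Fin 3) ℂ))
    (hirr : ∀ W : Submodule ℂ (Fin 3 → ℂ), (∀ a ∈ S, ∀ w ∈ W, a *ᵥ w ∈ W) → W = ⊥ ∨ W = ⊤) :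
    Algebra.adjoin ℂ S = ⊤ := by
  let e : Matrix (Fin 3) (Fin 3) ℂ ≃ₐ[ℂ] Module.End ℂ (Fin 3 → ℂ) := Matrix.toLinAlgEquiv'
  have h := burnside_end ((Algebra.adjoin ℂ S).map e.toAlgHom) (by
    intro W hW
    apply hirr W
    intro a ha w hw
    have := hW (e a) ⟨a, Algebra.subset_adjoin ha, rfl⟩ w hw
    simpa [e] using this)
  rw [eq_top_iff]
  rintro M -
  have : e M ∈ (Algebra.adjoin ℂ S).map e.toAlgHom := by rw [h]; trivial
  obtain ⟨N, hN, hNM⟩ := this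
  have : N = M := e.injective hNM
  exact this ▸ hN

/-- entrywise complex conjugation -/
def cj : Matrix (Fin 3) (Fin 3) ℂ →+* Matrix (Fin 3) (Fin 3) ℂ := (starRingEnd ℂ).mapMatrix

lemma cj_apply (A : Matrix (Fin 3) (Fin 3) ℂ) (i j : Fin 3) :
    cj A i j = (starRingEnd ℂ) (A i j) := rfl

lemma cj_cj (A : Matrix (Fin 3) (Fin 3) ℂ) : cj (cj A) = A := by
  ext i j; simp [cj_apply]

lemma cj_smul (c : ℂ) (A : Matrix (Fin 3) (Fin 3) ℂ) :
    cj (c • A) = (starRingEnd ℂ) c • cj A := by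
  ext i j; simp [cj_apply]

lemma cj_det (A : Matrix (Fin 3) (Fin 3) ℂ) : (cj A).det = (starRingEnd ℂ) A.det := by
  rw [cj, ← RingHom.map_det]

lemma cj_trace (A : Matrix (Fin 3) (Fin 3) ℂ) : (cj A).trace = (starRingEnd ℂ) A.trace := by
  simp [Matrix.trace, cj_apply]

lemma cj_transpose (A : Matrix (Fin 3) (Fin 3) ℂ) : (cj A)ᵀ = Aᴴ := by
  ext i j; simp [cj_apply]

lemma cj_inv {A : Matrix (Fin 3) (Fin 3) ℂ} (h : IsUnit A.det) : cj A⁻¹ = (cj A)⁻¹ := by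
  symm
  apply Matrix.inv_eq_right_inv
  rw [← map_mul, Matrix.mul_nonsing_inv _ h, map_one]

/-- existence of the intertwiner with the conjugate representation -/
lemma exists_X (G : Submonoid (Matrix (Fin 3) (Fin 3) ℂ))
    (hG : Algebra.adjoin ℂ (G : Set (Matrix (Fin 3) (Fin 3) ℂ)) = ⊤)
    (htr : ∀ g ∈ G, (starRingEnd ℂ) g.trace = g.trace) :
    ∃ X : Matrix (Fin 3) (Fin 3) ℂ, IsUnit X.det ∧ ∀ g ∈ G, cj g * X = X * g := by
  let D : Submonoid (Matrix (Fin 3) (Fin 3) ℂ × Matrix (Fin 3) (Fin 3) ℂ) :=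
    G.map ((MonoidHom.id _).prod (cj : Matrix (Fin 3) (Fin 3) ℂ →* Matrix (Fin 3) (Fin 3) ℂ))
  have hD : ∀ g ∈ G, (g, cj g) ∈ D := fun g hg => ⟨g, hg, rfl⟩
  let P := Algebra.adjoin ℂ (D : Set (Matrix (Fin 3) (Fin 3) ℂ × Matrix (Fin 3) (Fin 3) ℂ))
  have hP : ∀ g ∈ G, (g, cj g) ∈ P := fun g hg => Algebra.subset_adjoin (hD g hg)
  have htrP : ∀ x ∈ P, x.1.trace = x.2.trace := by
    intro x hx
    have hx' : x ∈ Submodule.span ℂ (D : Set (Matrix (Fin 3) (Fin 3) ℂ × Matrix (Fin 3) (Fin 3) ℂ)) := by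
      have := Algebra.adjoin_eq_span_of_subset (R := ℂ)
        (s := (D : Set (Matrix (Fin 3) (Fin 3) ℂ × Matrix (Fin 3) (Fin 3) ℂ)))
        (by rw [Submonoid.closure_eq]; exact Submodule.subset_span)
      rw [← this]; exact hx
    clear hx
    induction hx' using Submodule.span_induction with
    | mem x h =>
      obtain ⟨g, hg, rfl⟩ := h
      change g.trace = (cj g).trace
      rw [cj_trace, htr g hg]
    | zero => simp
    | add x y hx hy h1 h2 =>
      rw [Prod.fst_add, Prod.snd_add, Matrix.trace_add, Matrix.trace_add, h1, h2]
    | smul c x hx h =>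
      rw [Prod.smul_fst, Prod.smul_snd, Matrix.trace_smul, Matrix.trace_smul, h]
  let p1 : P →ₐ[ℂ] Matrix (Fin 3) (Fin 3) ℂ := (AlgHom.fst ℂ _ _).comp P.val
  let p2 : P →ₐ[ℂ] Matrix (Fin 3) (Fin 3) ℂ := (AlgHom.snd ℂ _ _).comp P.val
  have s1 : Function.Surjective p1 := by
    rw [← AlgHom.range_eq_top, eq_top_iff, ← hG]
    apply Algebra.adjoin_le
    intro g hg
    exact ⟨⟨(g, cj g), hP g hg⟩, rfl⟩
  have i2 : Function.Injective p2 := by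
    rw [injective_iff_map_eq_zero]
    rintro ⟨⟨a, b⟩, hab⟩ hb
    change b = 0 at hb
    subst hb
    have h0 : ∀ M : Matrix (Fin 3) (Fin 3) ℂ, (a * M).trace = 0 := by
      intro M
      obtain ⟨⟨⟨m, n⟩, hmn⟩, rfl⟩ := s1 M
      have := htrP _ (P.mul_mem hab hmn)
      change (a * m).trace = 0
      simpa using this
    have : a = 0 := by
      ext i j
      have := h0 (Matrix.single j i 1)
      simpa [Matrix.trace_mul_single] using this
    subst this
    rfl
  have fr : Module.finrank ℂ P = Module.finrank ℂ (Matrix (Fin 3) (Fin 3) ℂ) :=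
    le_antisymm (LinearMap.finrank_le_finrank_of_injective (f := p2.toLinearMap) i2)
      (LinearMap.finrank_le_finrank_of_surjective (f := p1.toLinearMap) s1)
  have i1 : Function.Injective p1 :=
    (LinearMap.injective_iff_surjective_of_finrank_eq_finrank (f := p1.toLinearMap) fr).2 s1
  have s2 : Function.Surjective p2 :=
    (LinearMap.injective_iff_surjective_of_finrank_eq_finrank (f := p2.toLinearMap) fr).1 i2
  let e1 := AlgEquiv.ofBijective p1 ⟨i1, s1⟩
  let e2 := AlgEquiv.ofBijective p2 ⟨i2, s2⟩
  let e : Matrix (Fin 3) (Fin 3) ℂ ≃ₐ[ℂ] Module.End ℂ (Fin 3 → ℂ) := Matrix.toLinAlgEquiv'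
  let φ := e1.symm.trans e2
  have hφ : ∀ g ∈ G, φ g = cj g := by
    intro g hg
    have : e1.symm g = ⟨(g, cj g), hP g hg⟩ := by
      rw [AlgEquiv.symm_apply_eq]; rfl
    change e2 (e1.symm g) = _
    rw [this]; rfl
  obtain ⟨T, hT⟩ := AlgEquiv.eq_linearEquivConjAlgEquiv ((e.symm.trans φ).trans e)
  have hTT : ∀ g, e (φ g) ∘ₗ T.toLinearMap = T.toLinearMap ∘ₗ e g := by
    intro g
    have := congrArg (fun f => f (e g)) hT
    simp at this
    rw [this]
    ext; simp
  refine ⟨e.symm T.toLinearMap, ?_, ?_⟩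
  · rw [← Matrix.isUnit_iff_isUnit_det]
    apply IsUnit.map
    exact ⟨⟨T.toLinearMap, T.symm.toLinearMap, by ext; simp, by ext; simp⟩, rfl⟩
  · intro g hg
    apply e.injective
    rw [map_mul, map_mul, e.apply_symm_apply, ← hφ g hg]
    exact hTT g

/-- the commutant of a spanning set consists of scalars -/
lemma commutant_scalar (S : Set (Matrix (Fin 3) (Fin 3) ℂ))
    (hG : Algebra.adjoin ℂ S = ⊤) (N : Matrix (Fin 3) (Fin 3) ℂ)
    (hN : ∀ g ∈ S, g * N = N * g) : ∃ c : ℂ, N = c • 1 := by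
  have hall : ∀ M : Matrix (Fin 3) (Fin 3) ℂ, M * N = N * M := by
    intro M
    have hle : Algebra.adjoin ℂ S ≤ Subalgebra.centralizer ℂ {N} := by
      apply Algebra.adjoin_le
      intro g hg
      rw [SetLike.mem_coe, Subalgebra.mem_centralizer_iff]
      intro n hn
      rw [Set.mem_singleton_iff.1 hn]
      exact (hN g hg).symm
    have : M ∈ Subalgebra.centralizer ℂ {N} := hle (by rw [hG]; trivial)
    rw [Subalgebra.mem_centralizer_iff] at this
    exact (this N rfl).symm
  obtain ⟨c, hc⟩ := Matrix.mem_range_scalar_of_commute_single (M := N)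
    (fun i j _ => hall (Matrix.single i j 1))
  refine ⟨c, ?_⟩
  rw [← hc]
  ext i j
  simp [Matrix.scalar_apply, Matrix.diagonal_apply, Matrix.one_apply]

/-- normalised intertwiner -/
lemma exists_X_norm (S : Set (Matrix (Fin 3) (Fin 3) ℂ))
    (hG : Algebra.adjoin ℂ S = ⊤) (X : Matrix (Fin 3) (Fin 3) ℂ) (hX : IsUnit X.det)
    (hXg : ∀ g ∈ S, cj g * X = X * g) :
    ∃ Y : Matrix (Fin 3) (Fin 3) ℂ, cj Y * Y = 1 ∧ ∀ g ∈ S, cj g * Y = Y * g := by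
  obtain ⟨c, hc⟩ := commutant_scalar S hG (cj X * X) (by
    intro g hg
    have h1 := hXg g hg
    have h2 := congrArg cj h1
    rw [map_mul, map_mul, cj_cj] at h2
    rw [← mul_assoc, h2, mul_assoc, h1, mul_assoc])
  have hd : (starRingEnd ℂ) X.det * X.det = c ^ 3 := by
    rw [← cj_det, ← Matrix.det_mul, hc]; simp
  have hc' : X * cj X = c • 1 := by
    have h1 : X⁻¹ * X = 1 := Matrix.nonsing_inv_mul _ hX
    have h2 : X * X⁻¹ = 1 := Matrix.mul_nonsing_inv _ hX
    calc X * cj X = X * (cj X * X) * X⁻¹ := by rw [mul_assoc, mul_assoc, h2, mul_one]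
      _ = c • 1 := by rw [hc]; simp [h2]
  have hcr : (starRingEnd ℂ) c = c := by
    have := congrArg cj hc'
    rw [map_mul, cj_cj, hc, cj_smul, map_one] at this
    have := congrFun (congrFun this 0) 0
    simpa using this.symm
  obtain ⟨r, rfl⟩ := Complex.conj_eq_iff_real.1 hcr
  have hr : 0 < r := by
    rw [← Complex.normSq_eq_conj_mul_self] at hd
    have hd' : Complex.normSq X.det = r ^ 3 := by exact_mod_cast hd
    have : 0 < Complex.normSq X.det := Complex.normSq_pos.2 hX.ne_zero
    rw [hd'] at this
    by_contra hneg
    have : r ^ 3 ≤ 0 := Odd.pow_nonpos (by decide) (not_lt.1 hneg)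
    linarith
  refine ⟨((Real.sqrt r)⁻¹ : ℝ) • X, ?_, ?_⟩
  · have h1 : (((Real.sqrt r)⁻¹ : ℝ) • X : Matrix (Fin 3) (Fin 3) ℂ) = ((((Real.sqrt r)⁻¹ : ℝ) : ℂ)) • X := by
      ext i j; simp
    rw [h1, cj_smul, Complex.conj_ofReal, smul_mul_smul_comm, hc, smul_smul, ← Complex.ofReal_mul,
      ← Complex.ofReal_mul, ← mul_inv, Real.mul_self_sqrt hr.le, inv_mul_cancel₀ hr.ne']
    simp
  · intro g hg
    simp [hXg g hg]

/-- Hilbert 90 -/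
lemma exists_T (Y : Matrix (Fin 3) (Fin 3) ℂ) (hY : cj Y * Y = 1) :
    ∃ T : Matrix (Fin 3) (Fin 3) ℂ, IsUnit T.det ∧ cj T * Y = T := by
  have key : ∀ m : ℂ, cj (m • Y + (starRingEnd ℂ) m • 1) * Y = m • Y + (starRingEnd ℂ) m • 1 := by
    intro m
    rw [map_add, cj_smul, cj_smul, map_one, add_mul, smul_mul_assoc, hY]
    simp [add_comm]
  by_contra hcon
  push Not at hcon
  have hdet : ∀ m : ℂ, (m • Y + (starRingEnd ℂ) m • 1).det = 0 := by
    intro m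
    by_contra h
    exact hcon _ (isUnit_iff_ne_zero.2 h) (key m)
  -- points m = 1 + t i
  have hroot : ∀ t : ℝ, (Matrix.charpoly Y).eval (-((1 - t * I) / (1 + t * I))) = 0 := by
    intro t
    have hne : (1 + t * I : ℂ) ≠ 0 := by
      intro h
      have := congrArg Complex.re h
      simp at this
    have := hdet (1 + t * I)
    rw [Matrix.eval_charpoly]
    have e : (Matrix.scalar (Fin 3) (-((1 - t * I) / (1 + t * I))) - Y)
        = (-(1 + t * I)⁻¹ : ℂ) • ((1 + t * I : ℂ) • Y + (starRingEnd ℂ) (1 + t * I : ℂ) • 1) := by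
      have hs : Matrix.scalar (Fin 3) (-((1 - t * I) / (1 + t * I)))
        = (-((1 - t * I) / (1 + t * I))) • (1 : Matrix (Fin 3) (Fin 3) ℂ) := by
        ext i j; simp [Matrix.diagonal_apply, Matrix.one_apply]
      rw [hs, smul_add, smul_smul, smul_smul, neg_mul, inv_mul_cancel₀ hne]
      simp only [map_add, map_one, map_mul, Complex.conj_ofReal, Complex.conj_I]
      rw [neg_one_smul, neg_add_eq_sub]
      congr 2
      field_simp
      ring
    rw [e, Matrix.det_smul, this, mul_zero]
  have hinj : Function.Injective (fun t : ℝ => (-((1 - t * I) / (1 + t * I)) : ℂ)) := by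
    intro s t h
    have hne : ∀ t : ℝ, (1 + t * I : ℂ) ≠ 0 := by
      intro t h
      have := congrArg Complex.re h
      simp at this
    have h1 := hne s
    have h2 := hne t
    simp only [neg_inj] at h
    rw [div_eq_div_iff h1 h2] at h
    have := congrArg Complex.im h
    simp at this
    linarith
  have hinf : Set.Infinite {x | (Matrix.charpoly Y).IsRoot x} := by
    refine (Set.infinite_range_of_injective hinj).mono ?_
    rintro _ ⟨t, rfl⟩
    exact hroot t
  exact (Matrix.charpoly_monic Y).ne_zero (Polynomial.eq_zero_of_infinite_isRoot _ hinf)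

lemma J21_det : J21.det = -1 := by
  simp [J21, Matrix.det_fin_three]

lemma cj_J21 : cj J21 = J21 := by
  ext i j; fin_cases i <;> fin_cases j <;> simp [cj_apply, J21]

lemma J21_herm : J21ᴴ = J21 := by
  ext i j; fin_cases i <;> fin_cases j <;> simp [J21]

lemma diag_congr (d : Fin 3 → ℝ) (h : d 0 * d 1 * d 2 < 0) :
    ∃ M : Matrix (Fin 3) (Fin 3) ℝ,
      Matrix.diagonal d = Mᵀ * !![0,0,1;0,1,0;1,0,0] * M ∨ Matrix.diagonal d = -(Mᵀ * M) := by
  have main : ∀ a b c : ℝ, 0 < a → 0 < b → 0 < c →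
      ∃ p q r s : ℝ, p ^ 2 + p^2 = a ∧ q ^ 2 = b ∧ r ^ 2 + r^2 = c := by
    intro a b c ha hb hc
    refine ⟨Real.sqrt (a/2), Real.sqrt b, Real.sqrt (c/2), 0, ?_, ?_, ?_⟩
    · rw [Real.sq_sqrt (by positivity)]; ring
    · rw [Real.sq_sqrt hb.le]
    · rw [Real.sq_sqrt (by positivity)]; ring
  have h0 : d 0 ≠ 0 := by rintro h0; simp [h0] at h
  have h1 : d 1 ≠ 0 := by rintro h0; simp [h0] at h
  have h2 : d 2 ≠ 0 := by rintro h0; simp [h0] at h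
  rcases lt_or_gt_of_ne h0 with h0 | h0 <;> rcases lt_or_gt_of_ne h1 with h1 | h1 <;>
    rcases lt_or_gt_of_ne h2 with h2 | h2
  · refine ⟨Matrix.diagonal (fun i => Real.sqrt (- d i)), Or.inr ?_⟩
    have : ∀ i, 0 ≤ - d i := by intro i; fin_cases i <;> simp <;> linarith
    rw [Matrix.diagonal_transpose, Matrix.diagonal_mul_diagonal, Matrix.diagonal_neg]
    congr 1
    ext i
    simp [Real.mul_self_sqrt (this i)]
  · nlinarith [mul_pos (neg_pos.2 h0) (neg_pos.2 h1), mul_pos (mul_pos (neg_pos.2 h0) (neg_pos.2 h1)) h2]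
  · nlinarith [mul_pos (mul_pos (neg_pos.2 h0) (neg_pos.2 h2)) h1]
  · obtain ⟨p, q, r, s, hp, hq, hr⟩ := main (d 1) (d 2) (- d 0) h1 h2 (by linarith)
    refine ⟨!![r, p, 0; 0, 0, q; -r, p, 0], Or.inl ?_⟩
    ext i j
    fin_cases i <;> fin_cases j <;> simp [Matrix.mul_apply, Fin.sum_univ_three] <;> linarith
  · nlinarith [mul_pos (mul_pos (neg_pos.2 h1) (neg_pos.2 h2)) h0]
  · obtain ⟨p, q, r, s, hp, hq, hr⟩ := main (d 0) (d 2) (- d 1) h0 h2 (by linarith)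
    refine ⟨!![p, r, 0; 0, 0, q; p, -r, 0], Or.inl ?_⟩
    ext i j
    fin_cases i <;> fin_cases j <;> simp [Matrix.mul_apply, Fin.sum_univ_three] <;> linarith
  · obtain ⟨p, q, r, s, hp, hq, hr⟩ := main (d 0) (d 1) (- d 2) h0 h1 (by linarith)
    refine ⟨!![p, 0, r; 0, q, 0; p, 0, -r], Or.inl ?_⟩
    ext i j
    fin_cases i <;> fin_cases j <;> simp [Matrix.mul_apply, Fin.sum_univ_three] <;> linarith
  · nlinarith [mul_pos (mul_pos h0 h1) h2]

lemma sym_congr (H : Matrix (Fin 3) (Fin 3) ℝ) (hs : Hᵀ = H) (hd : H.det < 0) :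
    ∃ M : Matrix (Fin 3) (Fin 3) ℝ,
      H = Mᵀ * !![0,0,1;0,1,0;1,0,0] * M ∨ H = -(Mᵀ * M) := by
  have hH : H.IsHermitian := by
    ext i j
    have := congrFun (congrFun hs i) j
    simpa using this
  have hdet := hH.det_eq_prod_eigenvalues
  simp only [Fin.prod_univ_three, RCLike.ofReal_real_eq_id, id] at hdet
  rw [hdet] at hd
  obtain ⟨M, hM⟩ := diag_congr hH.eigenvalues hd
  have hsp := hH.spectral_theorem
  rw [Unitary.conjStarAlgAut_apply] at hsp
  set U : Matrix (Fin 3) (Fin 3) ℝ := (hH.eigenvectorUnitary : Matrix (Fin 3) (Fin 3) ℝ) with hU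
  have hsp' : H = U * Matrix.diagonal hH.eigenvalues * Uᵀ := hsp
  refine ⟨M * Uᵀ, ?_⟩
  rcases hM with hM | hM
  · left
    rw [hM] at hsp'
    simp only [Matrix.transpose_mul, Matrix.transpose_transpose, mul_assoc] at hsp' ⊢
    exact hsp'
  · right
    rw [hM] at hsp'
    simp only [Matrix.transpose_mul, Matrix.transpose_transpose, mul_assoc, mul_neg, neg_mul] at hsp' ⊢
    exact hsp'

lemma U21_det {A : Matrix (Fin 3) (Fin 3) ℂ} (h : Aᴴ * J21 * A = J21) :
    (starRingEnd ℂ) A.det * A.det = 1 := by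
  have := congrArg Matrix.det h
  rw [Matrix.det_mul, Matrix.det_mul, Matrix.det_conjTranspose, J21_det] at this
  have h2 : star A.det = (starRingEnd ℂ) A.det := rfl
  rw [h2] at this
  linear_combination -this

/-- scale a `U(2,1)` matrix into `SU(2,1)` -/
lemma U21_scale {A : Matrix (Fin 3) (Fin 3) ℂ} (h : Aᴴ * J21 * A = J21) :
    ∃ k : ℂ, k ≠ 0 ∧ InSU21 (k • A) := by
  have hd := U21_det h
  have hd0 : A.det ≠ 0 := by intro h0; simp [h0] at hd
  obtain ⟨k, hk⟩ := IsAlgClosed.exists_pow_nat_eq (A.det)⁻¹ (n := 3) (by norm_num)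
  have hk0 : k ≠ 0 := by
    rintro rfl
    simp at hk
    exact hd0 hk.symm
  have hnk : (starRingEnd ℂ) k * k = 1 := by
    have h1 : ‖A.det‖ = 1 := by
      rw [← Complex.normSq_eq_conj_mul_self] at hd
      have hd' : Complex.normSq A.det = 1 := by exact_mod_cast hd
      rw [Complex.normSq_eq_norm_sq] at hd'
      exact (pow_eq_one_iff_of_nonneg (norm_nonneg _) (by norm_num)).1 hd'
    have h2 : ‖k‖ ^ 3 = 1 := by
      rw [← norm_pow, hk, norm_inv, h1, inv_one]
    have h3 : ‖k‖ = 1 := (pow_eq_one_iff_of_nonneg (norm_nonneg _) (by norm_num)).1 h2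
    rw [← Complex.normSq_eq_conj_mul_self, Complex.normSq_eq_norm_sq, h3]
    simp
  refine ⟨k, hk0, ?_, ?_⟩
  · rw [Matrix.conjTranspose_smul, smul_mul_assoc, smul_mul_smul_comm, h]
    have : star k * k = 1 := hnk
    rw [this, one_smul]
  · rw [Matrix.det_smul]
    simp [hk, hd0]

lemma smul_conj_eq {A B : Matrix (Fin 3) (Fin 3) ℂ} {k : ℂ} (hk : k ≠ 0) (hA : IsUnit A.det) :
    (k • A) * B * (k • A)⁻¹ = A * B * A⁻¹ := by
  have : (k • A)⁻¹ = k⁻¹ • A⁻¹ := by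
    apply Matrix.inv_eq_right_inv
    rw [smul_mul_smul_comm, Matrix.mul_nonsing_inv _ hA, mul_inv_cancel₀ hk, one_smul]
  rw [this, smul_mul_assoc, smul_mul_smul_comm, mul_inv_cancel₀ hk, one_smul]

/-- The irreducible case. -/
lemma irreducible_case (G : Submonoid (Matrix (Fin 3) (Fin 3) ℂ))
    (hG : Algebra.adjoin ℂ (G : Set (Matrix (Fin 3) (Fin 3) ℂ)) = ⊤)
    (hU : ∀ g ∈ G, gᴴ * J21 * g = J21)
    (htr : ∀ g ∈ G, (starRingEnd ℂ) g.trace = g.trace) :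
    ∃ T : Matrix (Fin 3) (Fin 3) ℂ, InSU21 T ∧ ∀ g ∈ G, cj (T * g * T⁻¹) = T * g * T⁻¹ := by
  obtain ⟨X, hX, hXg⟩ := exists_X G hG htr
  obtain ⟨Y, hY, hYg⟩ := exists_X_norm G hG X hX hXg
  obtain ⟨T, hT, hTY⟩ := exists_T Y hY
  have hTi : T * T⁻¹ = 1 := Matrix.mul_nonsing_inv _ hT
  have hiT : T⁻¹ * T = 1 := Matrix.nonsing_inv_mul _ hT
  have hcT : IsUnit (cj T).det := by
    rw [cj_det]; exact hT.map _
  have hreal : ∀ g ∈ G, cj (T * g * T⁻¹) = T * g * T⁻¹ := by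
    intro g hg
    have h1 : cj T * cj g * Y = T * g := by
      rw [mul_assoc, hYg g hg, ← mul_assoc, hTY]
    have h2 : Y * T⁻¹ = (cj T)⁻¹ := by
      symm
      apply Matrix.inv_eq_right_inv
      rw [← mul_assoc, hTY, hTi]
    rw [map_mul, map_mul, cj_inv hT, ← h2, ← mul_assoc, h1]
  -- the transported Hermitian form
  set H : Matrix (Fin 3) (Fin 3) ℂ := (T⁻¹)ᴴ * J21 * T⁻¹ with hHdef
  have hHJ : Tᴴ * H * T = J21 := by
    have h3 : Tᴴ * (T⁻¹)ᴴ = 1 := by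
      rw [← Matrix.conjTranspose_mul, hiT, Matrix.conjTranspose_one]
    calc Tᴴ * H * T = (Tᴴ * (T⁻¹)ᴴ) * J21 * (T⁻¹ * T) := by rw [hHdef]; simp only [mul_assoc]
      _ = J21 := by rw [h3, hiT, one_mul, mul_one]
  have hHh : Hᴴ = H := by
    rw [hHdef]
    simp only [Matrix.conjTranspose_mul, Matrix.conjTranspose_conjTranspose, J21_herm, mul_assoc]
  have hHdet : H.det = -((Complex.normSq (T⁻¹).det : ℝ) : ℂ) := by
    rw [hHdef, Matrix.det_mul, Matrix.det_mul, Matrix.det_conjTranspose, J21_det,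
      Complex.normSq_eq_conj_mul_self]
    have h2 : star (T⁻¹).det = (starRingEnd ℂ) (T⁻¹).det := rfl
    rw [h2]; ring
  have hTi0 : (T⁻¹).det ≠ 0 := by
    intro h0
    have := congrArg Matrix.det hTi
    rw [Matrix.det_mul, h0] at this
    simp at this
  have hnpos : 0 < Complex.normSq (T⁻¹).det := Complex.normSq_pos.2 hTi0
  have hH0 : H.det ≠ 0 := by
    rw [hHdet]
    simpa using hTi0
  have hHu : IsUnit H.det := isUnit_iff_ne_zero.2 hH0
  have hHi : H * H⁻¹ = 1 := Matrix.mul_nonsing_inv _ hHu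
  have hiH : H⁻¹ * H = 1 := Matrix.nonsing_inv_mul _ hHu
  have hcH : cj H = Hᵀ := by
    have := cj_transpose H
    rw [hHh] at this
    rw [← this, Matrix.transpose_transpose, this]
  -- invariance
  have hinv : ∀ g ∈ G, (T * g * T⁻¹)ᴴ * H * (T * g * T⁻¹) = H := by
    intro g hg
    calc (T * g * T⁻¹)ᴴ * H * (T * g * T⁻¹) = (T⁻¹)ᴴ * (gᴴ * (Tᴴ * H * T) * g) * T⁻¹ := by
          simp only [Matrix.conjTranspose_mul, mul_assoc]
      _ = H := by rw [hHJ, hU g hg, hHdef]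
  have hinv2 : ∀ g ∈ G, (T * g * T⁻¹)ᴴ * cj H * (T * g * T⁻¹) = cj H := by
    intro g hg
    have h1 := congrArg cj (hinv g hg)
    have h2 : cj ((T * g * T⁻¹)ᴴ) = (T * g * T⁻¹)ᴴ := by
      rw [← cj_transpose, hreal g hg]
      have : cj ((T * g * T⁻¹)ᵀ) = (cj (T * g * T⁻¹))ᵀ := by
        ext i j; rfl
      rw [this, hreal g hg]
    rw [map_mul, map_mul, h2, hreal g hg] at h1
    exact h1
  have hcomm : ∀ g ∈ G, (T * g * T⁻¹) * (H⁻¹ * cj H) = (H⁻¹ * cj H) * (T * g * T⁻¹) := by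
    intro g hg
    set B := T * g * T⁻¹ with hB
    have h1 : Bᴴ * H * B = H := hinv g hg
    have h2 : Bᴴ * cj H * B = cj H := hinv2 g hg
    have h3 : (H⁻¹ * Bᴴ * H) * B = 1 := by
      rw [mul_assoc, mul_assoc, ← mul_assoc Bᴴ, h1, hiH]
    have h4 : B * (H⁻¹ * Bᴴ * H) = 1 := mul_eq_one_comm.1 h3
    calc B * (H⁻¹ * cj H) = B * (H⁻¹ * (Bᴴ * cj H * B)) := by rw [h2]
      _ = B * (H⁻¹ * (Bᴴ * (H * H⁻¹) * cj H * B)) := by rw [hHi, mul_one]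
      _ = (B * (H⁻¹ * Bᴴ * H)) * (H⁻¹ * cj H * B) := by simp only [mul_assoc]
      _ = _ := by rw [h4, one_mul]
  obtain ⟨k, hk⟩ := commutant_scalar G hG (T⁻¹ * (H⁻¹ * cj H) * T) (by
    intro g hg
    have h1 := hcomm g hg
    calc g * (T⁻¹ * (H⁻¹ * cj H) * T) = (T⁻¹ * T) * g * (T⁻¹ * (H⁻¹ * cj H) * T) := by
          rw [hiT, one_mul]
      _ = T⁻¹ * ((T * g * T⁻¹) * (H⁻¹ * cj H)) * T := by simp only [mul_assoc]
      _ = T⁻¹ * (H⁻¹ * cj H) * T * g * (T⁻¹ * T) := by rw [h1]; simp only [mul_assoc]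
      _ = _ := by rw [hiT, mul_one])
  have hk2 : Hᵀ = k • H := by
    rw [← hcH]
    calc cj H = H * T * (T⁻¹ * (H⁻¹ * cj H) * T) * T⁻¹ := by
          have : H * T * (T⁻¹ * (H⁻¹ * cj H) * T) * T⁻¹
            = H * (T * T⁻¹) * H⁻¹ * cj H * (T * T⁻¹) := by simp only [mul_assoc]
          rw [this, hTi, mul_one, mul_one, hHi, one_mul]
      _ = k • H := by
          rw [hk, mul_smul_comm, mul_one, smul_mul_assoc, mul_assoc, hTi, mul_one]
  have hksq : k ^ 2 = 1 := by
    have h1 : H = (k ^ 2) • H := by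
      have := congrArg Matrix.transpose hk2
      rw [Matrix.transpose_transpose, Matrix.transpose_smul, hk2, smul_smul, ← sq] at this
      exact this
    have h2 : (k ^ 2) • (1 : Matrix (Fin 3) (Fin 3) ℂ) = 1 := by
      rw [← hHi, ← smul_mul_assoc, ← h1]
    have := congrFun (congrFun h2 0) 0
    simpa using this
  have hk1 : k = 1 := by
    have h3 := congrArg Matrix.det hk2
    rw [Matrix.det_transpose, Matrix.det_smul] at h3
    simp only [Fintype.card_fin] at h3
    have h4 : k ^ 3 = 1 := by
      have : (k ^ 3 - 1) * H.det = 0 := by linear_combination -h3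
      rcases mul_eq_zero.1 this with h | h
      · linear_combination h
      · exact absurd h hH0
    calc k = k ^ 3 := by rw [pow_succ, hksq, one_mul]
      _ = 1 := h4
  rw [hk1, one_smul] at hk2
  rw [hk2] at hcH
  -- real matrix
  let H₀ : Matrix (Fin 3) (Fin 3) ℝ := H.map Complex.re
  have hH₀ : H = H₀.map Complex.ofReal := by
    ext i j
    have := congrFun (congrFun hcH i) j
    exact (Complex.conj_eq_iff_re.1 this).symm
  have hH₀d : H₀.det < 0 := by
    have h1 : ((H₀.det : ℝ) : ℂ) = H.det := by
      rw [hH₀]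
      exact RingHom.map_det Complex.ofRealHom H₀
    rw [hHdet] at h1
    have h2 : H₀.det = - Complex.normSq (T⁻¹).det := by exact_mod_cast h1
    linarith
  have hH₀s : H₀ᵀ = H₀ := by
    ext i j
    have := congrFun (congrFun hk2 i) j
    exact congrArg Complex.re this
  obtain ⟨M, hM⟩ := sym_congr H₀ hH₀s hH₀d
  let R : Matrix (Fin 3) (Fin 3) ℂ := M.map Complex.ofReal
  have hRc : cj R = R := by
    ext i j; simp [R, cj_apply]
  have hRt : Rᴴ = Rᵀ := by
    rw [← cj_transpose, hRc]
  let ρ := (Complex.ofRealHom).mapMatrix (m := Fin 3)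
  have hJ : ρ !![0,0,1;0,1,0;1,0,0] = J21 := by
    ext i j; fin_cases i <;> fin_cases j <;> simp [ρ, J21]
  have hρt : ρ Mᵀ = Rᵀ := by ext i j; rfl
  rcases hM with hM | hM
  · have hHR : H = Rᴴ * J21 * R := by
      have : H = ρ H₀ := hH₀
      rw [this, hM, map_mul, map_mul, hJ, hρt, hRt]
      rfl
    have hUT : (R * T)ᴴ * J21 * (R * T) = J21 := by
      rw [hHR] at hHJ
      simp only [Matrix.conjTranspose_mul, mul_assoc] at hHJ ⊢
      exact hHJ
    obtain ⟨c, hc0, hc⟩ := U21_scale hUT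
    have hdRT : IsUnit (R * T).det := by
      rw [isUnit_iff_ne_zero]
      intro h0
      have := U21_det hUT
      rw [h0] at this
      simp at this
    have hdR : IsUnit R.det := by
      rw [Matrix.det_mul] at hdRT
      exact isUnit_of_mul_isUnit_left hdRT
    refine ⟨c • (R * T), hc, ?_⟩
    intro g hg
    rw [smul_conj_eq hc0 hdRT, Matrix.mul_inv_rev]
    have : R * T * g * (T⁻¹ * R⁻¹) = R * (T * g * T⁻¹) * R⁻¹ := by simp only [mul_assoc]
    rw [this, map_mul, map_mul, hreal g hg, cj_inv hdR, hRc]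
  · exfalso
    have hHR : H = -(Rᴴ * R) := by
      have : H = ρ H₀ := hH₀
      rw [this, hM, map_neg, map_mul, hρt, hRt]
      rfl
    have hneg : J21 = -((R * T)ᴴ * (R * T)) := by
      rw [← hHJ, hHR]
      simp only [Matrix.conjTranspose_mul, mul_assoc, mul_neg, neg_mul]
    have := congrFun (congrFun hneg 1) 1
    simp only [J21, Matrix.neg_apply, Matrix.mul_apply (M := (R * T)ᴴ), Fin.sum_univ_three, Matrix.conjTranspose_apply] at this
    have h5 := congrArg Complex.re this
    have h6 : ∀ z : ℂ, 0 ≤ (star z * z).re := by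
      intro z
      have : star z * z = ((Complex.normSq z : ℝ) : ℂ) := (Complex.normSq_eq_conj_mul_self).symm
      rw [this]
      exact Complex.normSq_nonneg z
    simp only [Complex.neg_re, Complex.add_re] at h5
    have e : (!![0,0,1;0,1,0;1,0,0] : Matrix (Fin 3) (Fin 3) ℂ) 1 1 = 1 := by simp
    rw [e, Complex.one_re] at h5
    linarith [h6 ((R * T) 0 1), h6 ((R * T) 1 1), h6 ((R * T) 2 1)]

lemma herm_self_im (z : Fin 3 → ℂ) : (herm z z).im = 0 := by
  simp [herm]; ring

lemma herm_smul_self (c : ℝ) (z : Fin 3 → ℂ) :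
    herm ((c : ℂ) • z) ((c : ℂ) • z) = ((c ^ 2 : ℝ) : ℂ) * herm z z := by
  simp [herm]; ring

/-- `U(2,1)` acts transitively on unit positive vectors (up to sign). -/
lemma exists_reflection (z : Fin 3 → ℂ) (hz : herm z z = 1) (l : ℝ) (hl : l * l = 1)
    (hne : z 1 * l ≠ 1) :
    ∃ T : Matrix (Fin 3) (Fin 3) ℂ, Tᴴ * J21 * T = J21 ∧
      T *ᵥ z = ![0, (l : ℂ), 0] := by
  have hlc : (l : ℂ) * l = 1 := by exact_mod_cast hl
  set w : Fin 3 → ℂ := ![z 0, z 1 - l, z 2] with hw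
  have hzw : herm z w = 1 - z 1 * l := by
    rw [← hz]; simp [herm, hw]; ring
  have hb0 : herm z w ≠ 0 := by
    rw [hzw, sub_ne_zero]; exact hne.symm
  have hww : herm w w = herm z w + (starRingEnd ℂ) (herm z w) := by
    rw [hzw]
    simp only [herm] at hz
    simp [herm, hw]
    linear_combination hz + hlc
  set b := herm z w with hb
  have hbc : (starRingEnd ℂ) b ≠ 0 := by simpa using hb0
  have hrel : b⁻¹ * ((starRingEnd ℂ) b)⁻¹ * herm w w = b⁻¹ + ((starRingEnd ℂ) b)⁻¹ := by
    rw [hww]; field_simp; ring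
  set a := b⁻¹ with ha
  have hac : ((starRingEnd ℂ) b)⁻¹ = (starRingEnd ℂ) a := by rw [ha, map_inv₀]
  rw [hac] at hrel
  simp only [herm] at hrel
  refine ⟨!![1 - a * w 0 * (starRingEnd ℂ) (w 2), - a * w 0 * (starRingEnd ℂ) (w 1), - a * w 0 * (starRingEnd ℂ) (w 0);
     - a * w 1 * (starRingEnd ℂ) (w 2), 1 - a * w 1 * (starRingEnd ℂ) (w 1), - a * w 1 * (starRingEnd ℂ) (w 0);
     - a * w 2 * (starRingEnd ℂ) (w 2), - a * w 2 * (starRingEnd ℂ) (w 1), 1 - a * w 2 * (starRingEnd ℂ) (w 0)], ?_, ?_⟩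
  · clear_value w a
    ext i j
    fin_cases i <;> fin_cases j <;>
      simp [Matrix.mul_apply, Fin.sum_univ_three, J21]
    · linear_combination (w 2 * (starRingEnd ℂ) (w 2)) * hrel
    · linear_combination (w 2 * (starRingEnd ℂ) (w 1)) * hrel
    · linear_combination (w 2 * (starRingEnd ℂ) (w 0)) * hrel
    · linear_combination (w 1 * (starRingEnd ℂ) (w 2)) * hrel
    · linear_combination (w 1 * (starRingEnd ℂ) (w 1)) * hrel
    · linear_combination (w 1 * (starRingEnd ℂ) (w 0)) * hrel
    · linear_combination (w 0 * (starRingEnd ℂ) (w 2)) * hrel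
    · linear_combination (w 0 * (starRingEnd ℂ) (w 1)) * hrel
    · linear_combination (w 0 * (starRingEnd ℂ) (w 0)) * hrel
  · have hab : a * (z 0 * (starRingEnd ℂ) (w 2) + z 1 * (starRingEnd ℂ) (w 1) + z 2 * (starRingEnd ℂ) (w 0)) = 1 := by
      change a * herm z w = 1
      rw [← hb, ha, inv_mul_cancel₀ hb0]
    have w0 : w 0 = z 0 := rfl
    have w1 : w 1 = z 1 - l := rfl
    have w2 : w 2 = z 2 := rfl
    clear_value w a
    ext i
    fin_cases i <;> simp [Matrix.mulVec, dotProduct, Fin.sum_univ_three]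
    · linear_combination -w 0 * hab - w0
    · linear_combination -w 1 * hab - w1
    · linear_combination -w 2 * hab - w2

lemma exists_move (z : Fin 3 → ℂ) (hz : 0 < (herm z z).re) :
    ∃ T : Matrix (Fin 3) (Fin 3) ℂ, InSU21 T ∧ ∃ c : ℂ, c ≠ 0 ∧ T *ᵥ z = ![0, c, 0] := by
  set r := (herm z z).re with hr
  have hzr : herm z z = (r : ℂ) := by
    apply Complex.ext
    · simp [hr]
    · simp [herm_self_im]
  set s : ℝ := (Real.sqrt r)⁻¹ with hs
  have hs0 : s ≠ 0 := inv_ne_zero (Real.sqrt_pos.2 hz).ne'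
  have hs2 : s ^ 2 * r = 1 := by
    rw [hs, inv_pow, Real.sq_sqrt hz.le, inv_mul_cancel₀ hz.ne']
  have hz1 : herm ((s : ℂ) • z) ((s : ℂ) • z) = 1 := by
    rw [herm_smul_self, hzr, ← Complex.ofReal_mul, hs2, Complex.ofReal_one]
  obtain ⟨l, hl, T, hT, hTz⟩ : ∃ l : ℝ, l * l = 1 ∧ ∃ T : Matrix (Fin 3) (Fin 3) ℂ,
      Tᴴ * J21 * T = J21 ∧ T *ᵥ ((s : ℂ) • z) = ![0, (l : ℂ), 0] := by
    by_cases h : ((s : ℂ) • z) 1 = 1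
    · exact ⟨-1, by norm_num, exists_reflection _ hz1 (-1) (by norm_num) (by rw [h]; norm_num)⟩
    · exact ⟨1, by norm_num, exists_reflection _ hz1 1 (by norm_num) (by simpa using h)⟩
  obtain ⟨k, hk0, hk⟩ := U21_scale hT
  have hl0 : l ≠ 0 := by rintro rfl; simp at hl
  refine ⟨k • T, hk, k * (s : ℂ)⁻¹ * l, ?_, ?_⟩
  · have : (s : ℂ) ≠ 0 := by exact_mod_cast hs0
    have : (l : ℂ) ≠ 0 := by exact_mod_cast hl0
    positivity
  · have hsC : (s : ℂ) ≠ 0 := by exact_mod_cast hs0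
    have : z = (s : ℂ)⁻¹ • ((s : ℂ) • z) := by rw [smul_smul, inv_mul_cancel₀ hsC, one_smul]
    rw [this, Matrix.smul_mulVec, Matrix.mulVec_smul, hTz]
    ext i
    fin_cases i <;> simp
    ring

/-- no common eigenline implies irreducible -/
lemma irr_of_no_eigenline (G : Set (Matrix (Fin 3) (Fin 3) ℂ))
    (hU : ∀ g ∈ G, gᴴ * J21 * g = J21)
    (hno : ¬ ∃ z : Fin 3 → ℂ, z ≠ 0 ∧ ∀ g ∈ G, ∃ c : ℂ, g *ᵥ z = c • z)
    (W : Submodule ℂ (Fin 3 → ℂ)) (hW : ∀ a ∈ G, ∀ w ∈ W, a *ᵥ w ∈ W) : W = ⊥ ∨ W = ⊤ := by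
  by_contra hcon
  push Not at hcon
  obtain ⟨hb, ht⟩ := hcon
  have h3 : Module.finrank ℂ (Fin 3 → ℂ) = 3 := by simp
  have hlt : Module.finrank ℂ W < 3 := by
    exact lt_of_lt_of_eq (Submodule.finrank_lt ht) h3
  have hpos : 0 < Module.finrank ℂ W := by
    rw [Nat.pos_iff_ne_zero]
    intro h0
    exact hb (Submodule.finrank_eq_zero.1 h0)
  obtain h1 | h2 : Module.finrank ℂ W = 1 ∨ Module.finrank ℂ W = 2 := by omega
  · obtain ⟨⟨z, hzW⟩, hz0, hz⟩ := finrank_eq_one_iff'.1 h1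
    refine hno ⟨z, fun h => hz0 (Subtype.ext h), fun g hg => ?_⟩
    obtain ⟨c, hc⟩ := hz ⟨g *ᵥ z, hW g hg z hzW⟩
    exact ⟨c, (congrArg Subtype.val hc).symm⟩
  · obtain ⟨f, hf0, hfW⟩ := Submodule.exists_le_ker_of_lt_top W (lt_top_iff_ne_top.2 ht)
    have hWk : W = LinearMap.ker f := by
      apply Submodule.eq_of_le_of_finrank_le hfW
      have : Module.finrank ℂ (LinearMap.ker f) < 3 := by
        refine lt_of_lt_of_eq (Submodule.finrank_lt ?_) h3
        intro h
        exact hf0 (LinearMap.ker_eq_top.1 h)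
      omega
    obtain ⟨x0, hx0⟩ : ∃ x, f x ≠ 0 := by
      by_contra h
      push Not at h
      exact hf0 (LinearMap.ext h)
    have hfg : ∀ g ∈ G, ∃ c : ℂ, ∀ x, f (g *ᵥ x) = c * f x := by
      intro g hg
      refine ⟨f (g *ᵥ x0) * (f x0)⁻¹, fun x => ?_⟩
      have hm : x - (f x * (f x0)⁻¹) • x0 ∈ W := by
        rw [hWk, LinearMap.mem_ker]
        simp [hx0]
      have := hW g hg _ hm
      rw [hWk, LinearMap.mem_ker, Matrix.mulVec_sub, Matrix.mulVec_smul] at this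
      simp only [map_sub, map_smul, smul_eq_mul] at this
      linear_combination this
    -- the row vector of `f`
    let v : Fin 3 → ℂ := fun i => f (Pi.single i 1)
    have hfv : ∀ x, f x = v ⬝ᵥ x := by
      intro x
      rw [LinearMap.pi_apply_eq_sum_univ f x]
      simp only [dotProduct, v, smul_eq_mul]
      refine Finset.sum_congr rfl fun i _ => ?_
      rw [mul_comm]
      congr 2
      ext j
      simp [Pi.single_apply, eq_comm]
    have hv0 : v ≠ 0 := by
      intro h
      apply hx0
      rw [hfv, h, zero_dotProduct]
    have hvg : ∀ g ∈ G, ∃ c : ℂ, v ᵥ* g = c • v := by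
      intro g hg
      obtain ⟨c, hc⟩ := hfg g hg
      refine ⟨c, ?_⟩
      ext i
      have := hc (Pi.single i 1)
      rw [hfv, Matrix.dotProduct_mulVec] at this
      simpa [v] using this
    have hJ2 : J21 * J21 = 1 := by
      ext i j; fin_cases i <;> fin_cases j <;> simp [J21, Matrix.mul_apply, Fin.sum_univ_three]
    -- J times conj v is an eigenvector
    refine hno ⟨J21 *ᵥ star v, ?_, ?_⟩
    · intro h
      have h' := congrArg (fun x => J21 *ᵥ x) h
      simp only [Matrix.mulVec_mulVec, hJ2, Matrix.one_mulVec, Matrix.mulVec_zero] at h'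
      exact hv0 (star_eq_zero.1 h')
    · intro g hg
      obtain ⟨c, hc⟩ := hvg g hg
      have h1 : gᴴ *ᵥ star v = star c • star v := by
        have := congrArg star hc
        rwa [Matrix.star_vecMul, star_smul] at this
      have hgJ : g * J21 * gᴴ = J21 := by
        have h2 : (J21 * gᴴ * J21) * g = 1 := by
          rw [mul_assoc, mul_assoc, ← mul_assoc gᴴ, hU g hg, hJ2]
        have h3 : g * (J21 * gᴴ * J21) = 1 := mul_eq_one_comm.1 h2
        calc g * J21 * gᴴ = g * (J21 * gᴴ * J21) * J21 := by
              simp only [mul_assoc, hJ2, mul_one]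
          _ = J21 := by rw [h3, one_mul]
      have h4 : J21 *ᵥ star v = star c • (g *ᵥ (J21 *ᵥ star v)) := by
        conv_lhs => rw [← hgJ]
        rw [← Matrix.mulVec_mulVec, h1, Matrix.mulVec_smul, Matrix.mulVec_mulVec]
      have hc0 : star c ≠ 0 := by
        intro h0
        rw [h0, zero_smul] at h1
        apply hv0
        have h5 := congrArg (fun x => (g * J21) *ᵥ x) h1
        simp only [Matrix.mulVec_mulVec, hgJ, Matrix.mulVec_zero] at h5
        have h' := congrArg (fun x => J21 *ᵥ x) h5
        simp only [Matrix.mulVec_mulVec, hJ2, Matrix.one_mulVec, Matrix.mulVec_zero] at h'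
        exact star_eq_zero.1 h'
      refine ⟨(star c)⁻¹, ?_⟩
      conv_rhs => rw [h4]
      rw [smul_smul, inv_mul_cancel₀ hc0, one_smul]

lemma SU_isUnit {A : Matrix (Fin 3) (Fin 3) ℂ} (h : InSU21 A) : IsUnit A.det := by
  rw [h.2]; exact isUnit_one

/-- positive common eigenvector case -/
lemma eigenline_case (G : Set (Matrix (Fin 3) (Fin 3) ℂ))
    (hU : ∀ g ∈ G, gᴴ * J21 * g = J21)
    (z : Fin 3 → ℂ) (hz : 0 < (herm z z).re) (hzg : ∀ g ∈ G, ∃ c : ℂ, g *ᵥ z = c • z) :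
    ∃ T : Matrix (Fin 3) (Fin 3) ℂ, InSU21 T ∧ ∀ g ∈ G,
      (T * g * T⁻¹) 0 1 = 0 ∧ (T * g * T⁻¹) 1 0 = 0 ∧
      (T * g * T⁻¹) 1 2 = 0 ∧ (T * g * T⁻¹) 2 1 = 0 := by
  obtain ⟨T, hT, k, hk0, hTz⟩ := exists_move z hz
  refine ⟨T, hT, fun g hg => ?_⟩
  have hTi : T * T⁻¹ = 1 := Matrix.mul_nonsing_inv _ (SU_isUnit hT)
  have hiT : T⁻¹ * T = 1 := Matrix.nonsing_inv_mul _ (SU_isUnit hT)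
  obtain ⟨c, hc⟩ := hzg g hg
  have hJT : (T⁻¹)ᴴ * J21 * T⁻¹ = J21 := by
    have h3 : (T⁻¹)ᴴ * Tᴴ = 1 := by
      rw [← Matrix.conjTranspose_mul, hTi, Matrix.conjTranspose_one]
    calc (T⁻¹)ᴴ * J21 * T⁻¹ = (T⁻¹)ᴴ * (Tᴴ * J21 * T) * T⁻¹ := by rw [hT.1]
      _ = ((T⁻¹)ᴴ * Tᴴ) * J21 * (T * T⁻¹) := by simp only [mul_assoc]
      _ = J21 := by rw [h3, hTi, one_mul, mul_one]
  set B := T * g * T⁻¹ with hB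
  have hBU : Bᴴ * J21 * B = J21 := by
    calc Bᴴ * J21 * B = (T⁻¹)ᴴ * (gᴴ * (Tᴴ * J21 * T) * g) * T⁻¹ := by
          rw [hB]; simp only [Matrix.conjTranspose_mul, mul_assoc]
      _ = J21 := by rw [hT.1, hU g hg, hJT]
  have hBe : B *ᵥ ![0, k, 0] = c • ![0, k, 0] := by
    rw [← hTz, Matrix.mulVec_mulVec, hB, mul_assoc, hiT, mul_one, ← Matrix.mulVec_mulVec, hc,
      Matrix.mulVec_smul]
  have e0 := congrFun hBe 0
  have e2 := congrFun hBe 2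
  simp [Matrix.mulVec, dotProduct, Fin.sum_univ_three, hk0] at e0 e2
  have q0 := congrFun (congrFun hBU 0) 1
  have q1 := congrFun (congrFun hBU 1) 1
  have q2 := congrFun (congrFun hBU 2) 1
  simp [Matrix.mul_apply, Fin.sum_univ_three, J21, e0, e2] at q0 q1 q2
  have hB1 : B 1 1 ≠ 0 := by
    intro h; simp [h] at q1
  exact ⟨e0, by simpa [hB1] using q0, by simpa [hB1] using q2, e2⟩

/-- Theorem 3.1: a non-elementary discrete subgroup of SU(2,1) all of whose elements
have real trace is Fuchsian: it can be conjugated within SU(2,1) either into SO(2,1)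
(ℝ-Fuchsian) or into the stabilizer of the complex line with polar vector (0,1,0)
(ℂ-Fuchsian). -/
theorem real_trace_discrete_nonelementary_is_fuchsian
    (G : Subgroup (GL (Fin 3) ℂ))
    (hSU : ∀ g ∈ G, InSU21 (g : Matrix (Fin 3) (Fin 3) ℂ))
    (hdisc : DiscreteTopology G)
    (hne : ¬ ∃ S : Set (Submodule ℂ (Fin 3 → ℂ)), S.Finite ∧ S.Nonempty ∧
      (∀ W ∈ S, ∃ z : Fin 3 → ℂ, z ≠ 0 ∧ (herm z z).re ≤ 0 ∧ (herm z z).im = 0 ∧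
        W = Submodule.span ℂ {z}) ∧
      (∀ g ∈ G, ∀ W ∈ S,
        W.map (Matrix.mulVecLin (g : Matrix (Fin 3) (Fin 3) ℂ)) ∈ S))
    (htr : ∀ g ∈ G, ((g : Matrix (Fin 3) (Fin 3) ℂ).trace).im = 0) :
    ∃ T : Matrix (Fin 3) (Fin 3) ℂ, InSU21 T ∧
      ((∀ g ∈ G, ∀ i j : Fin 3,
          ((T * (g : Matrix (Fin 3) (Fin 3) ℂ) * T⁻¹) i j).im = 0) ∨
       (∀ g ∈ G,
          (T * (g : Matrix (Fin 3) (Fin 3) ℂ) * T⁻¹) 0 1 = 0 ∧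
          (T * (g : Matrix (Fin 3) (Fin 3) ℂ) * T⁻¹) 1 0 = 0 ∧
          (T * (g : Matrix (Fin 3) (Fin 3) ℂ) * T⁻¹) 1 2 = 0 ∧
          (T * (g : Matrix (Fin 3) (Fin 3) ℂ) * T⁻¹) 2 1 = 0)) := by
  classical
  let GM : Submonoid (Matrix (Fin 3) (Fin 3) ℂ) := G.toSubmonoid.map (Units.coeHom _)
  have hmem : ∀ g ∈ G, (g : Matrix (Fin 3) (Fin 3) ℂ) ∈ GM := fun g hg => ⟨g, hg, rfl⟩
  have hU : ∀ m ∈ GM, mᴴ * J21 * m = J21 := by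
    rintro _ ⟨g, hg, rfl⟩
    exact (hSU g hg).1
  by_cases hline : ∃ z : Fin 3 → ℂ, z ≠ 0 ∧
      ∀ g ∈ (GM : Set (Matrix (Fin 3) (Fin 3) ℂ)), ∃ c : ℂ, g *ᵥ z = c • z
  · obtain ⟨z, hz0, hzg⟩ := hline
    have hpos : 0 < (herm z z).re := by
      by_contra hnp
      apply hne
      refine ⟨{Submodule.span ℂ {z}}, Set.finite_singleton _, Set.singleton_nonempty _, ?_, ?_⟩
      · rintro W rfl
        exact ⟨z, hz0, not_lt.1 hnp, herm_self_im z, rfl⟩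
      · rintro g hg W rfl
        obtain ⟨c, hc⟩ := hzg _ (hmem g hg)
        have hc0 : c ≠ 0 := by
          rintro rfl
          rw [zero_smul] at hc
          apply hz0
          have h1 : ((g⁻¹ * g : GL (Fin 3) ℂ) : Matrix (Fin 3) (Fin 3) ℂ) *ᵥ z = 0 := by
            rw [Units.val_mul, ← Matrix.mulVec_mulVec, hc, Matrix.mulVec_zero]
          simpa using h1
        rw [Set.mem_singleton_iff, Submodule.map_span, Set.image_singleton, Matrix.mulVecLin_apply, hc]
        exact Submodule.span_singleton_smul_eq (isUnit_iff_ne_zero.2 hc0) z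
    obtain ⟨T, hT, h⟩ := eigenline_case GM hU z hpos hzg
    exact ⟨T, hT, Or.inr fun g hg => h _ (hmem g hg)⟩
  · have hG := burnside_mat GM (irr_of_no_eigenline GM hU hline)
    obtain ⟨T, hT, h⟩ := irreducible_case GM hG hU (by
      rintro _ ⟨g, hg, rfl⟩
      exact Complex.conj_eq_iff_im.2 (htr g hg))
    refine ⟨T, hT, Or.inl fun g hg i j => ?_⟩
    have := congrFun (congrFun (h _ (hmem g hg)) i) j
    exact Complex.conj_eq_iff_im.1 this
end
end

section
/- Let G be a subgroup of SL(2,ℂ) that is discrete (the subspace topology induced on G from SL(2,ℂ), with its natural matrix topology, is discrete) and non-elementary, meaning there is no nonempty finite set S of one-dimensional complex subspaces of ℂ² (points of the Riemann sphere ℂP¹) such that every element of G maps S into S. If for every g ∈ G the square of the trace (tr g)² is a nonnegative real number, then G is Fuchsian: there exists T ∈ SL(2,ℂ) such that for every g ∈ G all four entries of T g T⁻¹ are real, i.e. G is conjugate to a subgroup of SL(2,ℝ). -/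
open Matrix

noncomputable section

/-- The topology on SL(2,ℂ) induced from the natural matrix topology. -/
instance : TopologicalSpace (Matrix.SpecialLinearGroup (Fin 2) ℂ) :=
  TopologicalSpace.induced
    (fun g => (g : Matrix (Fin 2) (Fin 2) ℂ)) inferInstance

abbrev SL2 := Matrix.SpecialLinearGroup (Fin 2) ℂ

theorem slTopGroup : IsTopologicalGroup SL2 :=
  Matrix.SpecialLinearGroup.topologicalGroup

/-- The conclusion. -/
def IsReal (G : Subgroup SL2) : Prop :=
  ∃ T : SL2, ∀ g ∈ G, ∀ i j : Fin 2, ((T * g * T⁻¹ : SL2) i j).im = 0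

def Irred (G : Subgroup SL2) : Prop :=
  ∀ x y : ℂ, (x ≠ 0 ∨ y ≠ 0) → ∃ g ∈ G, x * (g 1 0 * x + g 1 1 * y) - y * (g 0 0 * x + g 0 1 * y) ≠ 0

def Unbdd (G : Subgroup SL2) : Prop :=
  ∀ C : ℝ, ∃ g ∈ G, ∃ i j, C < ‖g i j‖

theorem sl_det (g : SL2) : g 0 0 * g 1 1 - g 0 1 * g 1 0 = 1 := by
  have := g.2
  rwa [Matrix.det_fin_two] at this

theorem slmul (g h : SL2) (i j : Fin 2) : (g * h : SL2) i j = g i 0 * h 0 j + g i 1 * h 1 j := by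
  rw [Matrix.SpecialLinearGroup.coe_mul, Matrix.mul_apply, Fin.sum_univ_two]

theorem slinv (g : SL2) : (g⁻¹ : SL2) 0 0 = g 1 1 ∧ (g⁻¹ : SL2) 0 1 = - g 0 1 ∧
    (g⁻¹ : SL2) 1 0 = - g 1 0 ∧ (g⁻¹ : SL2) 1 1 = g 0 0 := by
  rw [Matrix.SpecialLinearGroup.coe_inv, Matrix.adjugate_fin_two]
  simp

theorem slmk (a b c d : ℂ) (h : a * d - b * c = 1) :
    ∃ g : SL2, g 0 0 = a ∧ g 0 1 = b ∧ g 1 0 = c ∧ g 1 1 = d :=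
  ⟨⟨!![a, b; c, d], by rw [Matrix.det_fin_two_of, h]⟩, rfl, rfl, rfl, rfl⟩

theorem slconj (T g : SL2) (i j : Fin 2) : (T * g * T⁻¹ : SL2) i j =
    (T i 0 * g 0 0 + T i 1 * g 1 0) * (T⁻¹ : SL2) 0 j +
    (T i 0 * g 0 1 + T i 1 * g 1 1) * (T⁻¹ : SL2) 1 j := by
  simp only [slmul]

/-- real split case -/
theorem caseReal (G : Subgroup SL2) (hI : Irred G)
    (ha : ∀ g ∈ G, (g 0 0).im = 0 ∧ (g 1 1).im = 0) : IsReal G := by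
  have hbc : ∀ g ∈ G, ∀ h ∈ G, (g 0 1 * h 1 0).im = 0 := by
    intro g hg h hh
    have h1 := (ha _ (G.mul_mem hg hh)).1
    have h2 := (ha g hg).1
    have h3 := (ha h hh).1
    have : (g * h : SL2) 0 0 = g 0 0 * h 0 0 + g 0 1 * h 1 0 := by
      simp [Matrix.mul_apply, Fin.sum_univ_two]
    rw [this, Complex.add_im, Complex.mul_im (g 0 0), h2, h3] at h1
    simpa using h1
  obtain ⟨g₀, hg₀, hb⟩ := hI 0 1 (by simp)
  obtain ⟨h₀, hh₀, hc⟩ := hI 1 0 (by simp)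
  have hb : g₀ 0 1 ≠ 0 := by simpa using hb
  have hc : h₀ 1 0 ≠ 0 := by simpa using hc
  obtain ⟨w, hw⟩ := IsAlgClosed.exists_pow_nat_eq (g₀ 0 1)⁻¹ (n := 2) (by norm_num)
  have hw0 : w ≠ 0 := by
    rintro rfl
    apply inv_ne_zero hb
    rw [← hw]; simp
  obtain ⟨T, t1, t2, t3, t4⟩ := slmk w 0 0 w⁻¹ (by field_simp; simp)
  refine ⟨T, ?_⟩
  intro g hg
  have e01 : w * g 0 1 * w = (g 0 1 * h₀ 1 0) * (g₀ 0 1 * h₀ 1 0)⁻¹ := by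
    have : w * g 0 1 * w = g 0 1 * w ^ 2 := by ring
    rw [this, hw]; field_simp
  have e10 : w⁻¹ * g 1 0 * w⁻¹ = g₀ 0 1 * g 1 0 := by
    have : w⁻¹ * g 1 0 * w⁻¹ = g 1 0 * (w ^ 2)⁻¹ := by field_simp
    rw [this, hw]; field_simp
  have e00 : w * g 0 0 * w⁻¹ = g 0 0 := by field_simp
  have e11 : w⁻¹ * g 1 1 * w = g 1 1 := by field_simp
  have i1 := hbc g hg h₀ hh₀
  have i2 := hbc g₀ hg₀ h₀ hh₀
  have i3 := hbc g₀ hg₀ g hg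
  have i4 := ha g hg
  intro i j
  obtain ⟨v1, v2, v3, v4⟩ := slinv T
  have s00 : (T * g * T⁻¹ : SL2) 0 0 = w * g 0 0 * w⁻¹ := by
    rw [slconj, v1, v3, t1, t2, t3, t4]; ring
  have s01 : (T * g * T⁻¹ : SL2) 0 1 = w * g 0 1 * w := by
    rw [slconj, v2, v4, t1, t2]; ring
  have s10 : (T * g * T⁻¹ : SL2) 1 0 = w⁻¹ * g 1 0 * w⁻¹ := by
    rw [slconj, v1, v3, t3, t4]; ring
  have s11 : (T * g * T⁻¹ : SL2) 1 1 = w⁻¹ * g 1 1 * w := by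
    rw [slconj, v2, v4, t1, t2, t3, t4]; ring
  have r01 : (g 0 1 * h₀ 1 0 * (g₀ 0 1 * h₀ 1 0)⁻¹).im = 0 := by
    rw [Complex.mul_im, Complex.inv_im, i1, i2]; simp
  match i, j with
  | 0, 0 => rw [s00, e00]; exact i4.1
  | 0, 1 => rw [s01, e01]; exact r01
  | 1, 0 => rw [s10, e10]; exact i3
  | 1, 1 => rw [s11, e11]; exact i4.2

/-- elliptic case -/
theorem caseUnit (G : Subgroup SL2) (hI : Irred G) (hU : Unbdd G)
    (ha : ∀ g ∈ G, g 1 1 = star (g 0 0)) : IsReal G := by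
  have hbc : ∀ g ∈ G, ∀ h ∈ G, g 1 0 * h 0 1 = star (g 0 1 * h 1 0) := by
    intro g hg h hh
    have h1 := ha _ (G.mul_mem hg hh)
    have h2 := ha g hg
    have h3 := ha h hh
    have e0 : (g * h : SL2) 0 0 = g 0 0 * h 0 0 + g 0 1 * h 1 0 := by
      simp [Matrix.mul_apply, Fin.sum_univ_two]
    have e1 : (g * h : SL2) 1 1 = g 1 0 * h 0 1 + g 1 1 * h 1 1 := by
      simp [Matrix.mul_apply, Fin.sum_univ_two]
    rw [e0, e1, h2, h3] at h1
    simp only [star_add, star_mul'] at h1 ⊢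
    linear_combination h1
  obtain ⟨g₀, hg₀, hb⟩ := hI 0 1 (by simp)
  obtain ⟨h₀, hh₀, hc⟩ := hI 1 0 (by simp)
  have hb : g₀ 0 1 ≠ 0 := by simpa using hb
  have hc : h₀ 1 0 ≠ 0 := by simpa using hc
  obtain ⟨k, hk⟩ : ∃ k : ℝ, ∀ g ∈ G, g 1 0 = k * star (g 0 1) := by
    have h1 : ∀ g ∈ G, g 1 0 = (star (g₀ 1 0) / g₀ 0 1) * star (g 0 1) := by
      intro g hg
      have := hbc g hg g₀ hg₀
      rw [star_mul'] at this
      field_simp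
      linear_combination this
    have h2 := h1 g₀ hg₀
    set κ := star (g₀ 1 0) / g₀ 0 1 with hκ
    have h3 : star κ = κ := by
      rw [hκ, star_div₀, star_star]
      rw [hκ] at h2
      have : star (g₀ 0 1) ≠ 0 := by simpa using hb
      field_simp
      field_simp at h2
      linear_combination h2
    refine ⟨κ.re, fun g hg => ?_⟩
    rw [h1 g hg]
    congr 1
    exact (Complex.conj_eq_iff_re.mp h3).symm
  have hdet : ∀ g ∈ G, ‖g 0 0‖ ^ 2 - k * ‖g 0 1‖ ^ 2 = 1 := by
    intro g hg
    have := sl_det g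
    rw [ha g hg, hk g hg] at this
    have e1 : g 0 0 * star (g 0 0) = ((‖g 0 0‖ ^ 2 : ℝ) : ℂ) := by
      simpa using Complex.mul_conj' (g 0 0)
    have e2 : g 0 1 * star (g 0 1) = ((‖g 0 1‖ ^ 2 : ℝ) : ℂ) := by
      simpa using Complex.mul_conj' (g 0 1)
    have : ((‖g 0 0‖ ^ 2 - k * ‖g 0 1‖ ^ 2 : ℝ) : ℂ) = ((1 : ℝ) : ℂ) := by
      rw [Complex.ofReal_sub, Complex.ofReal_mul, ← e1, ← e2]
      push_cast
      linear_combination this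
    exact_mod_cast this
  rcases lt_trichotomy k 0 with hneg | h0 | hpos
  · exfalso
    have b0 : ∀ g ∈ G, ‖g 0 0‖ ≤ 1 := by
      intro g hg
      have := hdet g hg
      nlinarith [norm_nonneg (g 0 0), mul_nonneg (neg_pos.2 hneg).le (sq_nonneg ‖g 0 1‖)]
    have b1 : ∀ g ∈ G, ‖g 0 1‖ ≤ 1 + (-k)⁻¹ := by
      intro g hg
      have := hdet g hg
      have h1 : ‖g 0 1‖ ^ 2 ≤ (-k)⁻¹ := by
        rw [← one_div, le_div_iff₀ (by linarith)]
        nlinarith [sq_nonneg ‖g 0 0‖]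
      nlinarith [norm_nonneg (g 0 1), sq_nonneg (‖g 0 1‖ - 1)]
    have hk' : 0 < (-k)⁻¹ := inv_pos.2 (by linarith)
    obtain ⟨g, hg, i, j, hij⟩ := hU (max (1 + (-k)⁻¹) (-k * (1 + (-k)⁻¹)))
    rw [max_lt_iff] at hij
    have := b0 g hg
    have h1 := b1 g hg
    have h2 : ‖g 1 1‖ = ‖g 0 0‖ := by rw [ha g hg, norm_star]
    have h3 : ‖g 1 0‖ = -k * ‖g 0 1‖ := by
      rw [hk g hg, norm_mul, norm_star, Complex.norm_real, Real.norm_eq_abs, abs_of_neg hneg]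
    have h4 : -k * ‖g 0 1‖ ≤ -k * (1 + (-k)⁻¹) :=
      mul_le_mul_of_nonneg_left h1 (by linarith)
    fin_cases i <;> fin_cases j <;> simp only [Fin.zero_eta, Fin.mk_one] at hij <;> linarith [hij.1, hij.2]
  · exfalso
    apply hc
    rw [hk h₀ hh₀, h0]; simp
  · obtain ⟨s, hs, hsk⟩ : ∃ s : ℝ, 0 < s ∧ s ^ 2 = k :=
      ⟨√k, Real.sqrt_pos.2 hpos, Real.sq_sqrt hpos.le⟩
    have hs0 : (s : ℂ) ≠ 0 := by exact_mod_cast hs.ne'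
    obtain ⟨w, hw⟩ := IsAlgClosed.exists_pow_nat_eq (Complex.I / (2 * s)) (n := 2) (by norm_num)
    obtain ⟨T, t1, t2, t3, t4⟩ := slmk (-Complex.I * s * w) (-Complex.I * w) (-s * w) w (by
      have : -Complex.I * s * w * w - -Complex.I * w * (-s * w) = - 2 * Complex.I * s * w ^ 2 := by
        ring
      rw [this, hw]
      field_simp
      simp)
    refine ⟨T, ?_⟩
    intro g hg
    have e1 := hk g hg
    have e2 := ha g hg
    rw [← hsk] at e1
    push_cast at e1
    have fin : ∀ u z : ℂ, u = w ^ 2 * (Complex.I * z) → z.im = 0 → u.im = 0 := by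
      intro u z h1 h2
      have : Complex.I / (2 * s) * (Complex.I * z) = ((- 1/ (2 * s) : ℝ) : ℂ) * z := by
        push_cast
        field_simp
        simp
      rw [h1, hw, this, Complex.im_ofReal_mul, h2]; simp
    have II := Complex.I_mul_I
    obtain ⟨v1, v2, v3, v4⟩ := slinv T
    have s00 : ((T * g * T⁻¹ : SL2) 0 0).im = 0 := by
      refine fin _ (-(s * g 0 0 + s * s * star (g 0 1) + s * s * g 0 1 + s * star (g 0 0))) ?_ ?_
      · rw [slconj, v1, v3, t1, t2, t3, t4, e1, e2]; ring
      · simp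
    have s11 : ((T * g * T⁻¹ : SL2) 1 1).im = 0 := by
      refine fin _ (-s * g 0 0 + s * s * star (g 0 1) + s * s * g 0 1 - s * star (g 0 0)) ?_ ?_
      · rw [slconj, v2, v4, t1, t2, t3, t4, e1, e2]; ring
      · simp
    have s01 : ((T * g * T⁻¹ : SL2) 0 1).im = 0 := by
      refine fin _ (-Complex.I * (s * g 0 0 + s * s * star (g 0 1) - s * s * g 0 1 - s * star (g 0 0))) ?_ ?_
      · rw [slconj, v2, v4, t1, t2, e1, e2]; ring
      · simp
    have s10 : ((T * g * T⁻¹ : SL2) 1 0).im = 0 := by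
      refine fin _ (-Complex.I * (-s * g 0 0 + s * s * star (g 0 1) - s * s * g 0 1 + s * star (g 0 0))) ?_ ?_
      · rw [slconj, v1, v3, t3, t4, e1, e2]
        linear_combination (w ^ 2 * (-s * g 0 0 + s * s * star (g 0 1) - s * s * g 0 1 + s * star (g 0 0))) * II
      · simp
    intro i j
    match i, j with
    | 0, 0 => exact s00
    | 0, 1 => exact s01
    | 1, 0 => exact s10
    | 1, 1 => exact s11

theorem caseDiag (G : Subgroup SL2) (hI : Irred G) (hU : Unbdd G)
    (htr : ∀ g ∈ G, (g 0 0 + g 1 1).im = 0) (D : SL2) (hD : D ∈ G) (h01 : D 0 1 = 0)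
    (h10 : D 1 0 = 0) (hne : D 0 0 ≠ D 1 1) : IsReal G := by
  have hdet := sl_det D
  have ht := htr D hD
  have h2 : ∀ g ∈ G, (D 0 0 * g 0 0 + D 1 1 * g 1 1).im = 0 := by
    intro g hg
    have := htr _ (G.mul_mem hD hg)
    rw [slmul, slmul, h01, h10] at this
    simpa using this
  rw [h01] at hdet
  generalize D 0 0 = l at *
  generalize D 1 1 = m at *
  have d1 := congrArg Complex.re hdet
  have d2 := congrArg Complex.im hdet
  simp at d1 d2 ht
  have hm : m.im = - l.im := by linarith
  rw [hm] at d1 d2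
  by_cases hl : l.im = 0
  · apply caseReal G hI
    intro g hg
    have h3 := h2 g hg
    have h4 := htr g hg
    simp at h3 h4
    rw [hm, hl] at h3
    have hre : l.re - m.re ≠ 0 := by
      intro h
      apply hne
      apply Complex.ext
      · linarith
      · rw [hm, hl]; simp
    have h5 : (g 1 1).im = - (g 0 0).im := by linarith
    rw [h5] at h3 ⊢
    have : (l.re - m.re) * (g 0 0).im = 0 := by linarith
    have := (mul_eq_zero.1 this).resolve_left hre
    simp [this]
  · apply caseUnit G hI hU
    intro g hg
    have h3 := h2 g hg
    have h4 := htr g hg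
    simp at h3 h4
    have hre : m.re = l.re := by
      have : l.im * (m.re - l.re) = 0 := by linarith
      linarith [(mul_eq_zero.1 this).resolve_left hl]
    rw [hm, hre] at h3
    have h5 : (g 1 1).im = - (g 0 0).im := by linarith
    rw [h5] at h3
    have : l.im * ((g 0 0).re - (g 1 1).re) = 0 := by linarith
    have := (mul_eq_zero.1 this).resolve_left hl
    apply Complex.ext
    · simp; linarith
    · simp [h5]

theorem existsNonParabolic (G : Subgroup SL2) (hI : Irred G) :
    ∃ g ∈ G, (g 0 0 + g 1 1) ^ 2 ≠ 4 := by
  by_contra! hall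
  obtain ⟨g, hg, hc⟩ := hI 1 0 (by simp)
  have hc : g 1 0 ≠ 0 := by simpa using hc
  have hdet := sl_det g
  have htg := hall g hg
  obtain ⟨ε, hε⟩ : ∃ ε, ε = (g 0 0 + g 1 1) / 2 := ⟨_, rfl⟩
  have hd : g 1 1 = 2 * ε - g 0 0 := by rw [hε]; ring
  obtain ⟨p, hp⟩ : ∃ p, p = g 0 0 - ε := ⟨_, rfl⟩
  have ha : g 0 0 = ε + p := by rw [hp]; ring
  obtain ⟨h, hh, hmove⟩ := hI p (g 1 0) (Or.inr hc)
  have h1 := hall h hh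
  have h2 := hall _ (G.mul_mem hg hh)
  have h3 := hall _ (G.mul_mem hg (G.mul_mem hg hh))
  simp only [slmul] at h2 h3
  rw [ha] at hd
  rw [ha, hd] at h2 h3 hdet htg
  generalize g 0 1 = q at *
  generalize g 1 0 = c at *
  generalize h 0 0 = x at *
  generalize h 0 1 = y at *
  generalize h 1 0 = z at *
  generalize h 1 1 = u at *
  have he : ε ^ 2 = 1 := by linear_combination htg / 4
  have hq : p ^ 2 + q * c = 0 := by linear_combination he - hdet
  obtain ⟨n, hn⟩ : ∃ n, n = p * x + q * z + c * y - p * u := ⟨_, rfl⟩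
  have h2' : (ε * (x + u) + n) ^ 2 = 4 := by rw [← h2, hn]; ring
  have h3' : ((x + u) + 2 * ε * n) ^ 2 = 4 := by
    rw [← h3]
    congr 1
    rw [hn]
    linear_combination (- (x + u)) * he - (x + u) * hq
  have hnn : n ^ 2 = 0 := by
    linear_combination (h3' - h1 - 2 * (h2' - h1) + 2 * (x + u) ^ 2 * he - 4 * n ^ 2 * he) / 2
  have hn0 : n = 0 := by simpa using hnn
  apply hmove
  have : c * n = 0 := by rw [hn0]; simp
  rw [hn] at this
  linear_combination - this + z * hq

theorem diagonalize (g : SL2) (ht : (g 0 0 + g 1 1) ^ 2 ≠ 4) :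
    ∃ P : SL2, (P * g * P⁻¹ : SL2) 0 1 = 0 ∧ (P * g * P⁻¹ : SL2) 1 0 = 0 := by
  have hdet := sl_det g
  by_cases hc : g 1 0 = 0
  · have had : g 1 1 - g 0 0 ≠ 0 := by
      intro h
      apply ht
      rw [hc] at hdet
      linear_combination 4 * hdet + (g 1 1 - g 0 0) * h
    obtain ⟨P, t1, t2, t3, t4⟩ := slmk 1 (-(g 0 1 / (g 1 1 - g 0 0))) 0 1 (by simp)
    obtain ⟨v1, v2, v3, v4⟩ := slinv P
    refine ⟨P, ?_, ?_⟩
    · rw [slconj, v2, v4, t1, t2, hc]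
      field_simp
      ring
    · rw [slconj, v1, v3, t3, t4, hc]
      ring
  · obtain ⟨s, hs⟩ := IsAlgClosed.exists_pow_nat_eq ((g 0 0 + g 1 1) ^ 2 - 4) (n := 2) (by norm_num)
    have hs0 : s ≠ 0 := by
      rintro rfl
      apply ht
      linear_combination -hs
    generalize hca : g 0 0 = a at *
    generalize hcb : g 0 1 = b at *
    generalize hcc : g 1 0 = c at *
    generalize hcd : g 1 1 = d at *
    obtain ⟨P, t1, t2, t3, t4⟩ := slmk (1 / s) (-(((a + d - s) / 2 - d) / (c * s))) (-c)
      ((a + d + s) / 2 - d) (by field_simp; ring)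
    obtain ⟨v1, v2, v3, v4⟩ := slinv P
    refine ⟨P, ?_, ?_⟩
    · rw [slconj, v2, v4, t1, t2, hca, hcb, hcc, hcd]
      field_simp
      linear_combination -4 * hdet - hs
    · rw [slconj, v1, v3, t3, t4, hca, hcb, hcc, hcd]
      linear_combination c * hdet + c / 4 * hs

def cG (P : SL2) (G : Subgroup SL2) : Subgroup SL2 := G.map (MulAut.conj P).toMonoidHom

theorem mem_cG (P : SL2) (G : Subgroup SL2) (x : SL2) :
    x ∈ cG P G ↔ ∃ g ∈ G, P * g * P⁻¹ = x := by
  simp [cG, Subgroup.mem_map]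

theorem cG_real (P : SL2) (G : Subgroup SL2) (h : IsReal (cG P G)) : IsReal G := by
  obtain ⟨T, hT⟩ := h
  refine ⟨T * P, fun g hg i j => ?_⟩
  have := hT (P * g * P⁻¹) ((mem_cG _ _ _).2 ⟨g, hg, rfl⟩) i j
  rwa [show T * (P * g * P⁻¹) * T⁻¹ = T * P * g * (T * P)⁻¹ by group] at this

theorem conj_trace (P g : SL2) :
    (P * g * P⁻¹ : SL2) 0 0 + (P * g * P⁻¹ : SL2) 1 1 = g 0 0 + g 1 1 := by
  obtain ⟨v1, v2, v3, v4⟩ := slinv P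
  rw [slconj, slconj, v1, v2, v3, v4]
  linear_combination (g 0 0 + g 1 1) * sl_det P

theorem cG_irred (P : SL2) (G : Subgroup SL2) (h : Irred G) : Irred (cG P G) := by
  intro x y hxy
  have hP := sl_det P
  obtain ⟨x', hx'⟩ : ∃ x', x' = P 1 1 * x - P 0 1 * y := ⟨_, rfl⟩
  obtain ⟨y', hy'⟩ : ∃ y', y' = - P 1 0 * x + P 0 0 * y := ⟨_, rfl⟩
  have hx : x = P 0 0 * x' + P 0 1 * y' := by rw [hx', hy']; linear_combination -x * hP
  have hy : y = P 1 0 * x' + P 1 1 * y' := by rw [hx', hy']; linear_combination -y * hP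
  obtain ⟨g, hg, hne⟩ := h x' y' (by
    by_contra! hcon
    rw [hx, hy, hcon.1, hcon.2] at hxy
    simp at hxy)
  refine ⟨P * g * P⁻¹, (mem_cG _ _ _).2 ⟨g, hg, rfl⟩, ?_⟩
  intro h0
  apply hne
  obtain ⟨v1, v2, v3, v4⟩ := slinv P
  rw [slconj, slconj, slconj, slconj, v1, v2, v3, v4, hx, hy] at h0
  linear_combination h0 - (P 0 0 * P 1 1 - P 0 1 * P 1 0 + 1) *
    (x' * (g 1 0 * x' + g 1 1 * y') - y' * (g 0 0 * x' + g 0 1 * y')) * hP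

theorem bdd_entries (A : SL2) : ∃ M : ℝ, 0 ≤ M ∧ ∀ i j, ‖A i j‖ ≤ M := by
  refine ⟨‖A 0 0‖ + ‖A 0 1‖ + ‖A 1 0‖ + ‖A 1 1‖, by positivity, fun i j => ?_⟩
  have h1 := norm_nonneg (A 0 0)
  have h2 := norm_nonneg (A 0 1)
  have h3 := norm_nonneg (A 1 0)
  have h4 := norm_nonneg (A 1 1)
  match i, j with
  | 0, 0 => linarith
  | 0, 1 => linarith
  | 1, 0 => linarith
  | 1, 1 => linarith

theorem bdd_mul (A B : SL2) (M N : ℝ) (hM : 0 ≤ M) (hA : ∀ i j, ‖A i j‖ ≤ M)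
    (hB : ∀ i j, ‖B i j‖ ≤ N) (i j : Fin 2) : ‖(A * B : SL2) i j‖ ≤ 2 * M * N := by
  rw [slmul]
  have h1 : ‖A i 0 * B 0 j‖ ≤ M * N := by
    rw [norm_mul]; exact mul_le_mul (hA _ _) (hB _ _) (norm_nonneg _) hM
  have h2 : ‖A i 1 * B 1 j‖ ≤ M * N := by
    rw [norm_mul]; exact mul_le_mul (hA _ _) (hB _ _) (norm_nonneg _) hM
  linarith [norm_add_le (A i 0 * B 0 j) (A i 1 * B 1 j)]

theorem cG_unbdd (P : SL2) (G : Subgroup SL2) (h : Unbdd G) : Unbdd (cG P G) := by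
  intro C
  by_contra! hcon
  obtain ⟨M, hM0, hM⟩ := bdd_entries P⁻¹
  obtain ⟨N, hN0, hN⟩ := bdd_entries P
  have hC : 0 ≤ C := (norm_nonneg _).trans (hcon 1 (one_mem _) 0 0)
  obtain ⟨g, hg, i, j, hij⟩ := h (2 * (2 * M * C) * N)
  have h1 := hcon (P * g * P⁻¹) ((mem_cG _ _ _).2 ⟨g, hg, rfl⟩)
  have h2 := bdd_mul _ _ _ _ (by positivity) (bdd_mul _ _ _ _ hM0 hM h1) hN i j
  rw [show P⁻¹ * (P * g * P⁻¹) * P = g by group] at h2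
  linarith

theorem core (G : Subgroup SL2) (hI : Irred G) (hU : Unbdd G)
    (htr : ∀ g ∈ G, (g 0 0 + g 1 1).im = 0) : IsReal G := by
  obtain ⟨g, hg, hne⟩ := existsNonParabolic G hI
  obtain ⟨P, h01, h10⟩ := diagonalize g hne
  apply cG_real P
  refine caseDiag (cG P G) (cG_irred P G hI) (cG_unbdd P G hU) ?_ (P * g * P⁻¹)
    ((mem_cG _ _ _).2 ⟨g, hg, rfl⟩) h01 h10 ?_
  · intro x hx
    obtain ⟨k, hk, rfl⟩ := (mem_cG _ _ _).1 hx
    rw [conj_trace]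
    exact htr k hk
  · intro h
    apply hne
    have hd := sl_det (P * g * P⁻¹)
    rw [← conj_trace P g]
    rw [h01, ← h] at hd
    rw [← h]
    linear_combination 4 * hd

theorem finite_of_bdd (G : Subgroup SL2) (hdisc : DiscreteTopology G) (C : ℝ)
    (hC : ∀ g ∈ G, ∀ i j, ‖g i j‖ ≤ C) : (G : Set SL2).Finite := by
  haveI := slTopGroup
  have hemb : Topology.IsClosedEmbedding (fun g : SL2 => (g : Matrix (Fin 2) (Fin 2) ℂ)) := by
    refine ⟨⟨⟨rfl⟩, Subtype.val_injective⟩, ?_⟩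
    have : Set.range (fun g : SL2 => (g : Matrix (Fin 2) (Fin 2) ℂ)) = {A | A.det = 1} :=
      Subtype.range_coe
    rw [this]
    exact isClosed_eq (Continuous.matrix_det continuous_id) continuous_const
  haveI : T2Space SL2 := hemb.isEmbedding.t2Space
  have hcl : IsClosed (G : Set SL2) := Subgroup.isClosed_of_discrete
  have hK : IsCompact (Set.pi Set.univ (fun _ : Fin 2 => Set.pi Set.univ
      (fun _ : Fin 2 => Metric.closedBall (0 : ℂ) C))) :=
    isCompact_univ_pi fun _ => isCompact_univ_pi fun _ => isCompact_closedBall _ _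
  have hK' := hemb.isCompact_preimage hK
  have hG : IsCompact (G : Set SL2) := by
    refine hK'.of_isClosed_subset hcl ?_
    intro g hg i _ j _
    simpa using hC g hg i j
  exact hG.finite ⟨hdisc⟩

theorem mulVec_ne (g : SL2) (z : Fin 2 → ℂ) (hz : z ≠ 0) :
    (g : Matrix (Fin 2) (Fin 2) ℂ) *ᵥ z ≠ 0 := by
  intro h
  apply hz
  have : ((g⁻¹ : SL2) : Matrix (Fin 2) (Fin 2) ℂ) *ᵥ ((g : Matrix (Fin 2) (Fin 2) ℂ) *ᵥ z) = z := by
    rw [Matrix.mulVec_mulVec, ← Matrix.SpecialLinearGroup.coe_mul]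
    simp
  rw [← this, h, Matrix.mulVec_zero]

/-- Maskit's theorem: a non-elementary Kleinian group G ≤ SL(2,ℂ) in which
tr²(g) ≥ 0 for every g is Fuchsian, i.e. conjugate to a subgroup of SL(2,ℝ). -/
theorem nonneg_trace_sq_discrete_nonelementary_is_fuchsian
    (G : Subgroup (Matrix.SpecialLinearGroup (Fin 2) ℂ))
    (hdisc : DiscreteTopology G)
    (hne : ¬ ∃ S : Set (Submodule ℂ (Fin 2 → ℂ)), S.Finite ∧ S.Nonempty ∧
      (∀ W ∈ S, ∃ z : Fin 2 → ℂ, z ≠ 0 ∧ W = Submodule.span ℂ {z}) ∧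
      (∀ g ∈ G, ∀ W ∈ S,
        W.map (Matrix.mulVecLin (g : Matrix (Fin 2) (Fin 2) ℂ)) ∈ S))
    (htr : ∀ g ∈ G, (((g : Matrix (Fin 2) (Fin 2) ℂ).trace) ^ 2).im = 0 ∧
      0 ≤ (((g : Matrix (Fin 2) (Fin 2) ℂ).trace) ^ 2).re) :
    ∃ T : Matrix.SpecialLinearGroup (Fin 2) ℂ, ∀ g ∈ G, ∀ i j : Fin 2,
      (((T * g * T⁻¹ : Matrix.SpecialLinearGroup (Fin 2) ℂ) :
        Matrix (Fin 2) (Fin 2) ℂ) i j).im = 0 := by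
  have hI : Irred G := by
    intro x y hxy
    by_contra! hcon
    apply hne
    have hz : (![x, y] : Fin 2 → ℂ) ≠ 0 := by
      intro h
      have h0 := congrFun h 0
      have h1 := congrFun h 1
      simp at h0 h1
      rcases hxy with h | h
      · exact h h0
      · exact h h1
    refine ⟨{Submodule.span ℂ {![x, y]}}, Set.finite_singleton _, Set.singleton_nonempty _, ?_, ?_⟩
    · rintro W rfl
      exact ⟨_, hz, rfl⟩
    · rintro g hg W rfl
      have hc := hcon g hg
      rw [Set.mem_singleton_iff, Submodule.map_span, Set.image_singleton, Matrix.mulVecLin_apply]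
      have hgz := mulVec_ne g _ hz
      obtain ⟨c, hc⟩ : ∃ c : ℂ, (g : Matrix (Fin 2) (Fin 2) ℂ) *ᵥ ![x, y] = c • ![x, y] := by
        by_cases hx : x = 0
        · have hy : y ≠ 0 := hxy.resolve_left (by simpa using hx)
          refine ⟨(g 1 0 * x + g 1 1 * y) / y, ?_⟩
          ext i
          fin_cases i
          · simp [Matrix.mulVec, dotProduct, Fin.sum_univ_two, hx]
            rw [hx] at hc
            simpa [hy] using hc
          · simp [Matrix.mulVec, dotProduct, Fin.sum_univ_two]
            field_simp
        · refine ⟨(g 0 0 * x + g 0 1 * y) / x, ?_⟩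
          ext i
          fin_cases i
          · simp [Matrix.mulVec, dotProduct, Fin.sum_univ_two]
            field_simp
          · simp [Matrix.mulVec, dotProduct, Fin.sum_univ_two]
            field_simp
            linear_combination hc
      rw [hc]
      apply Submodule.span_singleton_smul_eq
      rw [isUnit_iff_ne_zero]
      rintro rfl
      apply hgz
      rw [hc, zero_smul]
  have hU : Unbdd G := by
    intro C
    by_contra! hcon
    have hfin := finite_of_bdd G hdisc C hcon
    apply hne
    have he : (![1, 0] : Fin 2 → ℂ) ≠ 0 := by
      intro h
      simpa using congrFun h 0
    refine ⟨(fun g : SL2 => Submodule.span ℂ {(g : Matrix (Fin 2) (Fin 2) ℂ) *ᵥ ![1, 0]}) '' G,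
      hfin.image _, ⟨_, 1, G.one_mem, rfl⟩, ?_, ?_⟩
    · rintro W ⟨g, hg, rfl⟩
      exact ⟨_, mulVec_ne g _ he, rfl⟩
    · rintro h hh W ⟨g, hg, rfl⟩
      refine ⟨h * g, G.mul_mem hh hg, ?_⟩
      dsimp only
      rw [Submodule.map_span, Set.image_singleton, Matrix.mulVecLin_apply, Matrix.mulVec_mulVec,
        Matrix.SpecialLinearGroup.coe_mul]
  have ht : ∀ g ∈ G, (g 0 0 + g 1 1).im = 0 := by
    intro g hg
    obtain ⟨h1, h2⟩ := htr g hg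
    rw [Matrix.trace_fin_two] at h1 h2
    generalize g 0 0 + g 1 1 = t at *
    rw [pow_two] at h1 h2
    simp only [Complex.mul_im, Complex.mul_re] at h1 h2
    have h3 : t.re * t.im = 0 := by linarith
    rcases mul_eq_zero.1 h3 with h | h
    · rw [h] at h2
      nlinarith
    · exact h
  exact core G hI hU ht
end
end
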